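/- If n = 4s for an integer s ≥ 4 (i.e., n ≥ 16 and n is divisible by 4), then the variety C_3(N_n) is reducible in the Zariski topology, i.e., it is not irreducible. -/

import Mathlib

open MvPolynomial Matrix TopologicalSpace

/-- The Zariski topology on `r`-tuples of `n × n` matrices over `k`, identified with
affine space `k^(r·n²)`: the topology generated by complements of hypersurfaces
(its closed sets are exactly the common zero loci of families of polynomials in the
matrix entries). -/
noncomputable def matTupleZariski (k : Type*) [CommRing k] (n r : ℕ) :
    TopologicalSpace (Fin r → Matrix (Fin n) (Fin n) k) :=
  TopologicalSpace.generateFrom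
    {U | ∃ p : MvPolynomial (Fin r × Fin n × Fin n) k,
      U = {x | MvPolynomial.eval (fun q => x q.1 q.2.1 q.2.2) p ≠ 0}}

/-- `C_r(N_n)`: the set of commuting `r`-tuples of nilpotent `n × n` matrices. -/
def nilCommTuples (k : Type*) [Field k] (n r : ℕ) :
    Set (Fin r → Matrix (Fin n) (Fin n) k) :=
  {x | (∀ i, IsNilpotent (x i)) ∧ ∀ i j, x i * x j = x j * x i}

/-- A subalgebra closed under those divisions that are possible in the ambient algebra. -/
def Subalgebra.IsDivClosed {k A : Type*} [CommRing k] [CommRing A] [Algebra k A]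
    (T : Subalgebra k A) : Prop :=
  ∀ a x : A, a ≠ 0 → a ∈ T → a * x ∈ T → x ∈ T

theorem isAlgebraic_of_forall_isDivClosed {k A : Type*} [CommRing k] [CommRing A] [IsDomain A]
    [Algebra k A] (S : Subalgebra k A)
    (h : ∀ T : Subalgebra k A, T.IsDivClosed → S ≤ T → T = ⊤) : Algebra.IsAlgebraic S A := by
  have := h ((Subalgebra.algebraicClosure S A).restrictScalars k) ?_ ?_
  · refine ⟨fun x ↦ ?_⟩
    have hx : x ∈ (Subalgebra.algebraicClosure S A).restrictScalars k := this ▸ Algebra.mem_top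
    exact hx
  · intro a x ha haT hax
    exact IsAlgebraic.of_mul (mem_nonZeroDivisors_of_ne_zero ha) haT hax
  · intro x hx
    exact isAlgebraic_algebraMap (⟨x, hx⟩ : S)

section MatrixEntries

variable {k A : Type*} [CommRing k] [CommRing A] [Algebra k A] (T : Subalgebra k A)
variable {l m n : Type*}

/-- All entries of the matrix lie in the subalgebra. -/
def Subalgebra.HasEntries (M : Matrix m n A) : Prop := ∀ i j, M i j ∈ T

variable {T}

theorem Subalgebra.HasEntries.mul [Fintype m] {M : Matrix l m A} {N : Matrix m n A}
    (hM : T.HasEntries M) (hN : T.HasEntries N) : T.HasEntries (M * N) := fun i j ↦ by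
  rw [Matrix.mul_apply]
  exact T.sum_mem fun x _ ↦ T.mul_mem (hM _ _) (hN _ _)

theorem Subalgebra.HasEntries.add {M N : Matrix m n A}
    (hM : T.HasEntries M) (hN : T.HasEntries N) : T.HasEntries (M + N) :=
  fun i j ↦ T.add_mem (hM i j) (hN i j)

theorem Subalgebra.HasEntries.sub {M N : Matrix m n A}
    (hM : T.HasEntries M) (hN : T.HasEntries N) : T.HasEntries (M - N) :=
  fun i j ↦ T.sub_mem (hM i j) (hN i j)

theorem Subalgebra.HasEntries.det [Fintype n] [DecidableEq n] {M : Matrix n n A}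
    (hM : T.HasEntries M) : M.det ∈ T := by
  rw [Matrix.det_apply]
  exact T.sum_mem fun σ _ ↦ T.zsmul_mem (T.prod_mem fun i _ ↦ hM _ _) _

theorem Subalgebra.HasEntries.adjugate [Fintype n] [DecidableEq n] {M : Matrix n n A}
    (hM : T.HasEntries M) : T.HasEntries M.adjugate := fun i j ↦ by
  rw [Matrix.adjugate_apply]
  refine Subalgebra.HasEntries.det fun a b ↦ ?_
  rw [Matrix.updateRow_apply]
  split_ifs
  · rw [Pi.single_apply]
    split_ifs
    exacts [T.one_mem, T.zero_mem]
  · exact hM _ _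

theorem Subalgebra.IsDivClosed.of_smul (hT : T.IsDivClosed) {a : A} {M : Matrix m n A}
    (ha : a ≠ 0) (haT : a ∈ T) (h : T.HasEntries (a • M)) : T.HasEntries M :=
  fun i j ↦ hT a _ ha haT (h i j)

theorem Subalgebra.IsDivClosed.of_mul_left [Fintype n] [DecidableEq n] (hT : T.IsDivClosed)
    {M : Matrix n n A} {Z : Matrix n m A} (hM : T.HasEntries M) (hd : M.det ≠ 0)
    (h : T.HasEntries (M * Z)) : T.HasEntries Z := by
  refine hT.of_smul hd hM.det ?_
  have := hM.adjugate.mul h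
  rwa [← Matrix.mul_assoc, Matrix.adjugate_mul, Matrix.smul_mul, Matrix.one_mul] at this

theorem Subalgebra.IsDivClosed.of_mul_right [Fintype n] [DecidableEq n] (hT : T.IsDivClosed)
    {M : Matrix n n A} {Z : Matrix m n A} (hM : T.HasEntries M) (hd : M.det ≠ 0)
    (h : T.HasEntries (Z * M)) : T.HasEntries Z := by
  refine hT.of_smul hd hM.det ?_
  have := h.mul hM.adjugate
  rwa [Matrix.mul_assoc, Matrix.mul_adjugate, Matrix.mul_smul, Matrix.mul_one] at this

end MatrixEntries

section Krylov

variable {A : Type*} [CommRing A] {n : ℕ} [NeZero n]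

/-- The matrix whose columns are `e₀, M e₀, M² e₀, …`. -/
def krylov (M : Matrix (Fin n) (Fin n) A) : Matrix (Fin n) (Fin n) A :=
  Matrix.of fun i j ↦ (M ^ (j : ℕ)) i 0

theorem krylov_zero (M : Matrix (Fin n) (Fin n) A) (i : Fin n) :
    krylov M i 0 = (1 : Matrix (Fin n) (Fin n) A) i 0 := by
  simp [krylov]

theorem mul_krylov (M N : Matrix (Fin n) (Fin n) A) (i j : Fin n) :
    (N * krylov M) i j = (N * M ^ (j : ℕ)) i 0 := by
  simp [Matrix.mul_apply, krylov]

theorem self_mul_krylov {M : Matrix (Fin n) (Fin n) A} (hM : M ^ n = 0) (i j : Fin n) :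
    (M * krylov M) i j = 0 ∨ ∃ l : Fin n, l ≠ 0 ∧ ∀ i, (M * krylov M) i j = krylov M i l := by
  by_cases hj : (j : ℕ) + 1 < n
  · refine Or.inr ⟨⟨j + 1, hj⟩, fun h ↦ ?_, fun i ↦ ?_⟩
    · simpa using congrArg Fin.val h
    · rw [mul_krylov, ← pow_succ']
      rfl
  · have : (j : ℕ) + 1 = n := by omega
    rw [mul_krylov, ← pow_succ', this, hM]
    simp

/-- The coordinates, up to the factor `det (krylov M)`, of `N e₀` in the Krylov basis. -/
def krylovCoord (M N : Matrix (Fin n) (Fin n) A) (j : Fin n) : A :=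
  ((krylov M).adjugate * N) j 0

theorem krylovCoord_zero [IsDomain A] {M N : Matrix (Fin n) (Fin n) A} (hM : M ^ n = 0)
    (hN : N ^ n = 0) (hc : Commute M N) (hd : (krylov M).det ≠ 0) : krylovCoord M N 0 = 0 := by
  set V := krylov M with hV
  set v : Matrix Unit (Fin n) A := Matrix.of fun _ j ↦ V.adjugate 0 j with hv
  have hvV (X : Matrix (Fin n) (Fin n) A) (j : Fin n) :
      (v * X) () j = (V.adjugate * X) 0 j := by
    simp [hv, Matrix.mul_apply]
  have cancel {x y : Matrix Unit (Fin n) A} (h : x * V = y * V) : x = y := by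
    have := congrArg (· * V.adjugate) h
    simp only [Matrix.mul_assoc, Matrix.mul_adjugate, Matrix.mul_smul, Matrix.mul_one] at this
    exact smul_right_injective _ hd this
  have h1 : v * M = 0 := by
    apply cancel
    ext ⟨⟩ j
    rw [Matrix.mul_assoc, hvV, Matrix.zero_mul, Matrix.zero_apply, Matrix.mul_apply]
    by_cases h : ∀ i, (M * V) i j = 0
    · simp [h]
    · push Not at h
      obtain ⟨i, hi⟩ := h
      obtain ⟨l, hl, hl'⟩ := (self_mul_krylov hM i j).resolve_left hi
      simp only [hV, hl']
      rw [← Matrix.mul_apply, Matrix.adjugate_mul]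
      simp [hl.symm]
  have h2 : V.det • (v * N) = krylovCoord M N 0 • v := by
    apply cancel
    ext ⟨⟩ j
    rw [Matrix.smul_mul, Matrix.smul_mul, Matrix.smul_apply, Matrix.smul_apply, hvV,
      Matrix.adjugate_mul, Matrix.mul_assoc, hvV, Matrix.mul_apply]
    simp only [hV, mul_krylov]
    rw [← Matrix.mul_apply, ← (hc.pow_left _).eq, ← hV, ← hvV, ← Matrix.mul_assoc]
    by_cases hj : j = 0
    · subst hj
      simp [hvV, krylovCoord, ← hV, mul_comm]
    · obtain ⟨t, ht⟩ : ∃ t, (j : ℕ) = t + 1 :=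
        Nat.exists_eq_succ_of_ne_zero fun h ↦ hj (Fin.ext (by simpa using h))
      rw [ht, pow_succ', ← Matrix.mul_assoc, h1]
      simp [Ne.symm hj]
  have h3 (r : ℕ) : V.det ^ r • (v * N ^ r) = krylovCoord M N 0 ^ r • v := by
    induction r with
    | zero => simp
    | succ r ih =>
      calc V.det ^ (r + 1) • (v * N ^ (r + 1))
          = V.det • ((V.det ^ r • (v * N ^ r)) * N) := by
            rw [pow_succ', pow_succ N, mul_smul, Matrix.smul_mul, Matrix.mul_assoc]
        _ = krylovCoord M N 0 ^ r • (V.det • (v * N)) := by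
            rw [ih, Matrix.smul_mul, smul_comm]
        _ = _ := by rw [h2, smul_smul, ← pow_succ]
  have h4 := h3 n
  rw [hN, Matrix.mul_zero, smul_zero] at h4
  have h5 : v ≠ 0 := by
    intro h
    have : (v * V) () 0 = V.det := by rw [hvV, Matrix.adjugate_mul]; simp
    rw [h] at this
    exact hd (by simpa using this.symm)
  exact eq_zero_of_pow_eq_zero ((smul_eq_zero.1 h4.symm).resolve_right h5)

theorem hasEntries_of_krylov {k : Type*} [CommRing k] [IsDomain A] [Algebra k A]
    {T : Subalgebra k A} (hT : T.IsDivClosed) {M : Matrix (Fin n) (Fin n) A} (hM : M ^ n = 0)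
    (hd : (krylov M).det ≠ 0) (h : ∀ i j, j ≠ 0 → krylov M i j ∈ T) :
    T.HasEntries (krylov M) ∧ T.HasEntries M := by
  have hV : T.HasEntries (krylov M) := by
    intro i j
    by_cases hj : j = 0
    · rw [hj, krylov_zero, Matrix.one_apply]
      split_ifs
      exacts [T.one_mem, T.zero_mem]
    · exact h i j hj
  refine ⟨hV, hT.of_mul_right hV hd fun i j ↦ ?_⟩
  obtain h0 | ⟨l, -, hl⟩ := self_mul_krylov hM i j
  · exact h0 ▸ T.zero_mem
  · exact hl i ▸ hV i l

theorem hasEntries_of_krylovCoord {k : Type*} [CommRing k] [IsDomain A] [Algebra k A]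
    {T : Subalgebra k A} (hT : T.IsDivClosed) {M N : Matrix (Fin n) (Fin n) A} (hM : M ^ n = 0)
    (hN : N ^ n = 0) (hc : Commute M N) (hd : (krylov M).det ≠ 0)
    (h : ∀ i j, j ≠ 0 → krylov M i j ∈ T) (h' : ∀ j, j ≠ 0 → krylovCoord M N j ∈ T) :
    T.HasEntries N := by
  obtain ⟨hV, hMT⟩ := hasEntries_of_krylov hT hM hd h
  have hq (j) : krylovCoord M N j ∈ T := by
    by_cases hj : j = 0
    · rw [hj, krylovCoord_zero hM hN hc hd]
      exact T.zero_mem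
    · exact h' j hj
  have hcol : T.HasEntries (Matrix.of fun i (_ : Unit) ↦ N i 0) := by
    refine hT.of_mul_left hV.adjugate ?_ fun i j ↦ ?_
    · rw [Matrix.det_adjugate]
      exact pow_ne_zero _ hd
    · simpa [krylovCoord, Matrix.mul_apply] using hq i
  refine hT.of_mul_right hV hd fun i j ↦ ?_
  rw [mul_krylov, ← (hc.pow_left _).eq, Matrix.mul_apply]
  refine T.sum_mem fun l _ ↦ T.mul_mem ?_ (hcol l ())
  have hp (r : ℕ) : T.HasEntries (M ^ r) := by
    induction r with
    | zero =>
      intro i j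
      rw [pow_zero, Matrix.one_apply]
      split_ifs
      exacts [T.one_mem, T.zero_mem]
    | succ r ih => rw [pow_succ]; exact ih.mul hMT
  exact hp _ _ _

end Krylov

section BlockFamily

theorem fromCols_neg_one_mul_fromRows_one_self {R m n : Type*} [CommRing R] [Fintype m]
    [Fintype n] [DecidableEq m] [DecidableEq n] (X : Matrix m n R) :
    fromCols (-X) (1 : Matrix m m R) * fromRows (1 : Matrix n n R) X = 0 := by
  simp [fromCols_mul_fromRows]

variable {R : Type*} [CommRing R] {α β : Type*} [Fintype α] [Fintype β] [DecidableEq α]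
  [DecidableEq β]

/-- The conjugate of the strictly block upper triangular matrix with blocks `B`, `A`, `C` by the
block unipotent lower triangular matrix given by `U` and `w`. -/
def blockNil (U : Matrix (β ⊕ α) α R) (w : Matrix α β R) (A : Matrix β α R) (B : Matrix α β R)
    (C : Matrix α α R) : Matrix (α ⊕ (β ⊕ α)) (α ⊕ (β ⊕ α)) R :=
  (fromRows (1 : Matrix α α R) U * fromCols (B - C * w) C +
      fromRows (0 : Matrix α (β ⊕ α) R) (1 : Matrix (β ⊕ α) (β ⊕ α) R) *
        (fromRows (1 : Matrix β β R) w * A * fromCols (-w) (1 : Matrix α α R))) *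
    fromCols (-U) (1 : Matrix (β ⊕ α) (β ⊕ α) R)

theorem blockNil_eq_fromBlocks (U : Matrix (β ⊕ α) α R) (w : Matrix α β R) (A : Matrix β α R)
    (B : Matrix α β R) (C : Matrix α α R) :
    blockNil U w A B C = fromBlocks (fromCols (B - C * w) C * -U) (fromCols (B - C * w) C)
      ((U * fromCols (B - C * w) C +
        fromRows (1 : Matrix β β R) w * A * fromCols (-w) (1 : Matrix α α R)) * -U)
      (U * fromCols (B - C * w) C +
        fromRows (1 : Matrix β β R) w * A * fromCols (-w) (1 : Matrix α α R)) := by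
  have h : fromRows (1 : Matrix α α R) U * fromCols (B - C * w) C +
      fromRows (0 : Matrix α (β ⊕ α) R) (1 : Matrix (β ⊕ α) (β ⊕ α) R) *
        (fromRows (1 : Matrix β β R) w * A * fromCols (-w) (1 : Matrix α α R)) =
      fromRows (fromCols (B - C * w) C) (U * fromCols (B - C * w) C +
        fromRows (1 : Matrix β β R) w * A * fromCols (-w) (1 : Matrix α α R)) := by
    rw [fromRows_mul, fromRows_mul, Matrix.one_mul, Matrix.zero_mul, Matrix.one_mul]
    ext (i | i) j <;> simp only [Matrix.add_apply, fromRows_apply_inl, fromRows_apply_inr,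
      Matrix.zero_apply, add_zero]
  rw [blockNil, h, fromRows_mul_fromCols, Matrix.mul_one, Matrix.mul_one]

theorem blockNil_mul (U : Matrix (β ⊕ α) α R) (w : Matrix α β R) (A A' : Matrix β α R)
    (B B' : Matrix α β R) (C C' : Matrix α α R) :
    blockNil U w A B C * blockNil U w A' B' C' =
      fromRows (1 : Matrix α α R) U * (B * A') * fromCols (-w) (1 : Matrix α α R) *
        fromCols (-U) (1 : Matrix (β ⊕ α) (β ⊕ α) R) := by
  have h1 := fromCols_neg_one_mul_fromRows_one_self U
  have h2 : fromCols (-U) (1 : Matrix (β ⊕ α) (β ⊕ α) R) *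
      fromRows (0 : Matrix α (β ⊕ α) R) (1 : Matrix (β ⊕ α) (β ⊕ α) R) = 1 := by
    simp [fromCols_mul_fromRows]
  have h3 := fromCols_neg_one_mul_fromRows_one_self w
  have h4 : fromCols (B - C * w) C * fromRows (1 : Matrix β β R) w = B := by
    simp [fromCols_mul_fromRows]
  have h5 : fromCols (-U) (1 : Matrix (β ⊕ α) (β ⊕ α) R) * blockNil U w A' B' C' =
      fromRows (1 : Matrix β β R) w * A' * fromCols (-w) (1 : Matrix α α R) *
        fromCols (-U) (1 : Matrix (β ⊕ α) (β ⊕ α) R) := by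
    rw [blockNil, ← Matrix.mul_assoc, Matrix.mul_add, ← Matrix.mul_assoc, h1, Matrix.zero_mul,
      zero_add, ← Matrix.mul_assoc, h2, Matrix.one_mul]
  rw [blockNil, Matrix.mul_assoc, h5]
  simp only [Matrix.add_mul, Matrix.mul_assoc]
  rw [← Matrix.mul_assoc (fromCols (-w) (1 : Matrix α α R)) (fromRows (1 : Matrix β β R) w), h3,
    Matrix.zero_mul, Matrix.mul_zero, Matrix.mul_zero, Matrix.mul_zero, add_zero,
    ← Matrix.mul_assoc (fromCols _ C) (fromRows (1 : Matrix β β R) w), h4]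

theorem blockNil_pow_three (U : Matrix (β ⊕ α) α R) (w : Matrix α β R) (A : Matrix β α R)
    (B : Matrix α β R) (C : Matrix α α R) : blockNil U w A B C ^ 3 = 0 := by
  have h1 := fromCols_neg_one_mul_fromRows_one_self U
  rw [pow_succ', pow_two, blockNil_mul, blockNil]
  simp only [Matrix.mul_assoc]
  rw [← Matrix.mul_assoc (fromCols (-U) (1 : Matrix (β ⊕ α) (β ⊕ α) R)), h1,
    Matrix.zero_mul, Matrix.mul_zero]

theorem hasEntries_of_blockNil {k : Type*} [CommRing k] [Algebra k R] [IsDomain R]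
    {T : Subalgebra k R} (hT : T.IsDivClosed) {ι : Type*} {U : Matrix (β ⊕ α) α R}
    {w : Matrix α β R} {A : ι → Matrix β α R} {B : ι → Matrix α β R} {C : ι → Matrix α α R}
    (h : ∀ i, T.HasEntries (blockNil U w (A i) (B i) (C i))) {i₀ i₁ : ι}
    (hd : (B i₀ * A i₁).det ≠ 0) :
    T.HasEntries U ∧ T.HasEntries w ∧
      ∀ i, T.HasEntries (A i) ∧ T.HasEntries (B i) ∧ T.HasEntries (C i) := by
  have hR (i) : T.HasEntries (fromCols (B i - C i * w) (C i)) := fun a b ↦ by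
    have := h i (Sum.inl a) (Sum.inr b)
    rwa [blockNil_eq_fromBlocks, fromBlocks_apply₁₂] at this
  have hS (i) : T.HasEntries (U * fromCols (B i - C i * w) (C i) +
      fromRows (1 : Matrix β β R) w * A i * fromCols (-w) (1 : Matrix α α R)) := fun a b ↦ by
    have := h i (Sum.inr a) (Sum.inr b)
    rwa [blockNil_eq_fromBlocks, fromBlocks_apply₂₂] at this
  have hP := (h i₀).mul (h i₁)
  set Z := B i₀ * A i₁ with hZ
  rw [blockNil_mul, Matrix.mul_assoc (fromRows 1 U), fromRows_mul, Matrix.one_mul,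
    fromRows_mul_fromCols, Matrix.mul_one, Matrix.mul_one, ← hZ] at hP
  have hW : T.HasEntries (Z * fromCols (-w) (1 : Matrix α α R)) := fun a b ↦ hP (.inl a) (.inr b)
  have hUW : T.HasEntries (U * (Z * fromCols (-w) (1 : Matrix α α R))) :=
    fun a b ↦ hP (.inr a) (.inr b)
  rw [mul_fromCols, Matrix.mul_one] at hW hUW
  rw [mul_fromCols] at hUW
  have hZT : T.HasEntries Z := fun a b ↦ hW a (.inr b)
  have hU : T.HasEntries U := hT.of_mul_right hZT hd fun a b ↦ hUW a (.inr b)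
  have hw : T.HasEntries w := by
    have hw' : T.HasEntries (-w) := hT.of_mul_left hZT hd fun a b ↦ hW a (.inl b)
    exact fun a b ↦ by simpa using T.neg_mem (hw' a b)
  refine ⟨hU, hw, fun i ↦ ?_⟩
  have hC : T.HasEntries (C i) := fun a b ↦ hR i a (.inr b)
  refine ⟨fun a b ↦ ?_, ?_, hC⟩
  · have := (hS i).sub (hU.mul (hR i)) (.inl a) (.inr b)
    rw [add_sub_cancel_left, mul_fromCols, Matrix.mul_one, fromRows_mul, Matrix.one_mul] at this
    exact this
  · have : T.HasEntries (B i - C i * w) := fun a b ↦ hR i a (.inl b)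
    simpa using this.add (hC.mul hw)

end BlockFamily

section CommutingBlocks

variable {R : Type*} [CommRing R] {α : Type*} [Fintype α] [DecidableEq α]

/-- Given `A₀, A₁, A₂`, the matrices `B₀, B₁, B₂` with `Bᵢ Aⱼ = Bⱼ Aᵢ` depending on the free
parameters `b` and `Y`. -/
def symmBlock (A : Fin 3 → Matrix (α ⊕ α) α R) (b : Matrix α (α ⊕ α) R) (Y : Matrix α α R) :
    Fin 3 → Matrix α (α ⊕ α) R :=
  ![(fromCols (A 0) (A 1)).det ^ 2 • b,
    (fromCols (A 0) (A 1)).det • (fromCols (b * A 1) Y * (fromCols (A 0) (A 1)).adjugate),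
    fromCols ((fromCols (A 0) (A 1)).det • (b * A 2))
      (fromCols (b * A 1) Y * (fromCols (A 0) (A 1)).adjugate * A 2) *
        (fromCols (A 0) (A 1)).adjugate]

theorem adjugate_fromCols_mul_left (M N : Matrix (α ⊕ α) α R) :
    (fromCols M N).adjugate * M = (fromCols M N).det • fromRows 1 0 := by
  have h := Matrix.adjugate_mul (fromCols M N)
  rw [mul_fromCols] at h
  ext i j
  have := congrFun (congrFun h i) (.inl j)
  cases i <;> simpa [Matrix.one_apply] using this

theorem adjugate_fromCols_mul_right (M N : Matrix (α ⊕ α) α R) :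
    (fromCols M N).adjugate * N = (fromCols M N).det • fromRows 0 1 := by
  have h := Matrix.adjugate_mul (fromCols M N)
  rw [mul_fromCols] at h
  ext i j
  have := congrFun (congrFun h i) (.inr j)
  cases i <;> simpa [Matrix.one_apply] using this

variable (A : Fin 3 → Matrix (α ⊕ α) α R) (b : Matrix α (α ⊕ α) R) (Y : Matrix α α R)

theorem symmBlock_one_mul_one :
    symmBlock A b Y 1 * A 1 = (fromCols (A 0) (A 1)).det ^ 2 • Y := by
  simp [symmBlock, Matrix.mul_assoc, adjugate_fromCols_mul_right, fromCols_mul_fromRows, smul_smul,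
    pow_two]

theorem symmBlock_mul_comm (i j : Fin 3) :
    symmBlock A b Y i * A j = symmBlock A b Y j * A i := by
  have h01 : symmBlock A b Y 0 * A 1 = symmBlock A b Y 1 * A 0 := by
    simp [symmBlock, Matrix.mul_assoc, adjugate_fromCols_mul_left, fromCols_mul_fromRows,
      smul_smul, pow_two]
  have h02 : symmBlock A b Y 0 * A 2 = symmBlock A b Y 2 * A 0 := by
    simp [symmBlock, Matrix.mul_assoc, adjugate_fromCols_mul_left, fromCols_mul_fromRows,
      smul_smul, pow_two]
  have h12 : symmBlock A b Y 1 * A 2 = symmBlock A b Y 2 * A 1 := by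
    simp [symmBlock, Matrix.mul_assoc, adjugate_fromCols_mul_right, fromCols_mul_fromRows]
  fin_cases i <;> fin_cases j <;>
    first | rfl | exact h01 | exact h02 | exact h12 | exact h01.symm | exact h02.symm |
      exact h12.symm

end CommutingBlocks

section GenericFamily

variable (k : Type*) [Field k] (s : ℕ)

/-- The `c`-th of `17` generic `s × s` matrices. -/
noncomputable def genericBlock (c : Fin 17) :
    Matrix (Fin s) (Fin s) (MvPolynomial (Fin 17 × Fin s × Fin s) k) :=
  Matrix.of fun i j ↦ X (c, i, j)

/-- The generic blocks `A₀, A₁, A₂`. -/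
noncomputable def genericA : Fin 3 →
    Matrix (Fin s ⊕ Fin s) (Fin s) (MvPolynomial (Fin 17 × Fin s × Fin s) k) :=
  ![fromRows (genericBlock k s 5) (genericBlock k s 6),
    fromRows (genericBlock k s 7) (genericBlock k s 8),
    fromRows (genericBlock k s 9) (genericBlock k s 10)]

/-- The generic blocks `B₀, B₁, B₂` with `Bᵢ Aⱼ = Bⱼ Aᵢ`. -/
noncomputable def genericB : Fin 3 →
    Matrix (Fin s) (Fin s ⊕ Fin s) (MvPolynomial (Fin 17 × Fin s × Fin s) k) :=
  symmBlock (genericA k s) (fromCols (genericBlock k s 11) (genericBlock k s 12))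
    (genericBlock k s 13)

/-- A commuting triple of nilpotent matrices depending on `17 s²` parameters. -/
noncomputable def genericNil (i : Fin 3) :
    Matrix (Fin s ⊕ ((Fin s ⊕ Fin s) ⊕ Fin s)) (Fin s ⊕ ((Fin s ⊕ Fin s) ⊕ Fin s))
      (MvPolynomial (Fin 17 × Fin s × Fin s) k) :=
  blockNil (fromRows (fromRows (genericBlock k s 0) (genericBlock k s 1)) (genericBlock k s 2))
    (fromCols (genericBlock k s 3) (genericBlock k s 4)) (genericA k s i) (genericB k s i)
    (![genericBlock k s 14, genericBlock k s 15, genericBlock k s 16] i)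

theorem genericNil_mul_comm (i j : Fin 3) :
    genericNil k s i * genericNil k s j = genericNil k s j * genericNil k s i := by
  rw [genericNil, genericNil, blockNil_mul, blockNil_mul, genericB, symmBlock_mul_comm]

theorem det_genericA_ne_zero : (fromCols (genericA k s 0) (genericA k s 1)).det ≠ 0 ∧
    (fromCols (genericBlock k s 11) (genericBlock k s 12) * genericA k s 1).det ≠ 0 := by
  set φ : MvPolynomial (Fin 17 × Fin s × Fin s) k →+* k := MvPolynomial.eval fun q ↦
    if q.1 = 5 ∨ q.1 = 8 ∨ q.1 = 12 then (1 : Matrix (Fin s) (Fin s) k) q.2.1 q.2.2 else 0 with hφ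
  have hX (c i j) : φ (genericBlock k s c i j) =
      if c = 5 ∨ c = 8 ∨ c = 12 then (1 : Matrix (Fin s) (Fin s) k) i j else 0 := by
    simp [hφ, genericBlock]
  have h1 : φ.mapMatrix (fromCols (genericA k s 0) (genericA k s 1)) = 1 := by
    ext (i | i) (j | j) <;> simp [genericA, hX, Matrix.one_apply]
  have h2 : φ.mapMatrix (fromCols (genericBlock k s 11) (genericBlock k s 12) * genericA k s 1) =
      1 := by
    ext i j
    simp [genericA, fromCols_mul_fromRows, Matrix.mul_apply, hX, Matrix.one_apply]
  constructor <;> intro h <;> replace h := congrArg φ h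
  · rw [RingHom.map_det, h1, Matrix.det_one, map_zero] at h
    exact one_ne_zero h
  · rw [RingHom.map_det, h2, Matrix.det_one, map_zero] at h
    exact one_ne_zero h

variable {k s}

theorem eq_top_of_hasEntries_genericNil
    {T : Subalgebra k (MvPolynomial (Fin 17 × Fin s × Fin s) k)} (hT : T.IsDivClosed)
    (h : ∀ i, T.HasEntries (genericNil k s i)) : T = ⊤ := by
  obtain ⟨hd, hd'⟩ := det_genericA_ne_zero k s
  have hB0 : genericB k s 0 = (fromCols (genericA k s 0) (genericA k s 1)).det ^ 2 •
      fromCols (genericBlock k s 11) (genericBlock k s 12) := rfl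
  obtain ⟨hU, hw, hABC⟩ := hasEntries_of_blockNil hT h (i₀ := 0) (i₁ := 1) <| by
    rw [hB0, Matrix.smul_mul, Matrix.det_smul]
    exact mul_ne_zero (pow_ne_zero _ (pow_ne_zero _ hd)) hd'
  have hg : T.HasEntries (fromCols (genericA k s 0) (genericA k s 1)) := by
    rintro i (j | j)
    exacts [(hABC 0).1 i j, (hABC 1).1 i j]
  have hb : T.HasEntries (fromCols (genericBlock k s 11) (genericBlock k s 12)) :=
    hT.of_smul (pow_ne_zero 2 hd) (T.pow_mem hg.det 2) (hB0 ▸ (hABC 0).2.1)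
  have hY : T.HasEntries (genericBlock k s 13) := by
    refine hT.of_smul (pow_ne_zero 2 hd) (T.pow_mem hg.det 2) ?_
    rw [← symmBlock_one_mul_one]
    exact (hABC 1).2.1.mul (hABC 1).1
  rw [eq_top_iff, ← MvPolynomial.adjoin_range_X, Algebra.adjoin_le_iff]
  rintro _ ⟨⟨c, i, j⟩, rfl⟩
  change genericBlock k s c i j ∈ T
  fin_cases c
  exacts [hU (.inl (.inl i)) j, hU (.inl (.inr i)) j, hU (.inr i) j, hw i (.inl j), hw i (.inr j),
    (hABC 0).1 (.inl i) j, (hABC 0).1 (.inr i) j, (hABC 1).1 (.inl i) j, (hABC 1).1 (.inr i) j,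
    (hABC 2).1 (.inl i) j, (hABC 2).1 (.inr i) j, hb i (.inl j), hb i (.inr j), hY i j,
    (hABC 0).2.2 i j, (hABC 1).2.2 i j, (hABC 2).2.2 i j]

theorem exists_commuting_nilpotent_generating (k : Type*) [Field k] (s : ℕ) :
    ∃ x : Fin 3 → Matrix (Fin (4 * s)) (Fin (4 * s)) (MvPolynomial (Fin 17 × Fin s × Fin s) k),
      (∀ i, IsNilpotent (x i)) ∧ (∀ i j, x i * x j = x j * x i) ∧
      ∀ T : Subalgebra k (MvPolynomial (Fin 17 × Fin s × Fin s) k), T.IsDivClosed →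
        (∀ i, T.HasEntries (x i)) → T = ⊤ := by
  let e : Fin s ⊕ ((Fin s ⊕ Fin s) ⊕ Fin s) ≃ Fin (4 * s) :=
    Fintype.equivFinOfCardEq (by simp; ring)
  let r := Matrix.reindexAlgEquiv k (MvPolynomial (Fin 17 × Fin s × Fin s) k) e
  refine ⟨fun i ↦ r (genericNil k s i), fun i ↦ ?_, fun i j ↦ ?_, fun T hT h ↦ ?_⟩
  · exact IsNilpotent.map ⟨3, blockNil_pow_three ..⟩ r
  · rw [← map_mul, genericNil_mul_comm, map_mul]
  · refine eq_top_of_hasEntries_genericNil hT fun i a b ↦ ?_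
    simpa [r] using h i (e a) (e b)

end GenericFamily

section VanishingIdeal

theorem Matrix.pow_card_eq_zero_of_isNilpotent {k n : Type*} [CommRing k] [IsDomain k] [Fintype n]
    [DecidableEq n] {M : Matrix n n k} (hM : IsNilpotent M) : M ^ Fintype.card n = 0 := by
  have h := (Matrix.isNilpotent_charpoly_sub_pow_of_isNilpotent hM).eq_zero
  have := Matrix.aeval_self_charpoly M
  rwa [sub_eq_zero.1 h, map_pow, Polynomial.aeval_X] at this

variable (k : Type*) [Field k] (n r : ℕ)

/-- The entries of a tuple of matrices, as a point of affine space. -/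
def tupleCoord {R : Type*} {n r : ℕ} (x : Fin r → Matrix (Fin n) (Fin n) R) :
    Fin r × Fin n × Fin n → R :=
  fun q ↦ x q.1 q.2.1 q.2.2

/-- The ideal of polynomials vanishing on `C_r(N_n)`. -/
noncomputable def nilCommIdeal : Ideal (MvPolynomial (Fin r × Fin n × Fin n) k) :=
  MvPolynomial.vanishingIdeal k (tupleCoord '' nilCommTuples k n r)

variable {k n r}

theorem mem_nilCommIdeal {p : MvPolynomial (Fin r × Fin n × Fin n) k} :
    p ∈ nilCommIdeal k n r ↔ ∀ x ∈ nilCommTuples k n r, eval (tupleCoord x) p = 0 := by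
  simp [nilCommIdeal, MvPolynomial.mem_vanishingIdeal_iff, MvPolynomial.aeval_eq_eval]

theorem nilCommIdeal_isPrime
    (h : @IsIrreducible _ (matTupleZariski k n r) (nilCommTuples k n r)) :
    (nilCommIdeal k n r).IsPrime := by
  let := matTupleZariski k n r
  obtain ⟨⟨x₀, hx₀⟩, hirr⟩ := h
  refine Ideal.isPrime_iff.2 ⟨fun htop ↦ ?_, fun {p q} hpq ↦ ?_⟩
  · have : (1 : MvPolynomial (Fin r × Fin n × Fin n) k) ∈ nilCommIdeal k n r :=
      htop ▸ Submodule.mem_top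
    simpa using mem_nilCommIdeal.1 this x₀ hx₀
  · by_contra! hne
    simp only [mem_nilCommIdeal, not_forall] at hne
    obtain ⟨⟨x, hx, hpx⟩, y, hy, hqy⟩ := hne
    obtain ⟨z, hz, hpz, hqz⟩ := hirr _ _ (isOpen_generateFrom_of_mem ⟨p, rfl⟩)
      (isOpen_generateFrom_of_mem ⟨q, rfl⟩) ⟨x, hx, hpx⟩ ⟨y, hy, hqy⟩
    exact mul_ne_zero hpz hqz ((map_mul (eval (tupleCoord z)) p q).symm.trans
      (mem_nilCommIdeal.1 hpq z hz))

variable (k n r)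

/-- The tautological matrices over the coordinate ring of `C_r(N_n)`. -/
noncomputable def tautMatrix (i : Fin r) :
    Matrix (Fin n) (Fin n) (MvPolynomial (Fin r × Fin n × Fin n) k ⧸ nilCommIdeal k n r) :=
  (Ideal.Quotient.mk (nilCommIdeal k n r)).mapMatrix (Matrix.of fun a b ↦ X (i, a, b))

variable {k n r}

theorem map_eval_of_X (x : Fin r → Matrix (Fin n) (Fin n) k) (i : Fin r) :
    (eval (tupleCoord x)).mapMatrix (Matrix.of fun a b ↦ X (i, a, b)) = x i := by
  ext a b
  simp [tupleCoord]

theorem map_mk_eq_map_mk {M N : Matrix (Fin n) (Fin n) (MvPolynomial (Fin r × Fin n × Fin n) k)}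
    (h : ∀ x ∈ nilCommTuples k n r,
      (eval (tupleCoord x)).mapMatrix M = (eval (tupleCoord x)).mapMatrix N) :
    (Ideal.Quotient.mk (nilCommIdeal k n r)).mapMatrix M =
      (Ideal.Quotient.mk (nilCommIdeal k n r)).mapMatrix N := by
  ext a b
  refine Ideal.Quotient.eq.2 (mem_nilCommIdeal.2 fun x hx ↦ ?_)
  rw [map_sub, sub_eq_zero]
  exact congrFun (congrFun (h x hx) a) b

theorem tautMatrix_commute (i j : Fin r) : Commute (tautMatrix k n r i) (tautMatrix k n r j) := by
  refine (map_mul _ _ _).symm.trans ((map_mk_eq_map_mk fun x hx ↦ ?_).trans (map_mul _ _ _))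
  rw [map_mul, map_mul, map_eval_of_X, map_eval_of_X, hx.2]

theorem tautMatrix_pow (i : Fin r) : tautMatrix k n r i ^ n = 0 := by
  rw [tautMatrix, ← map_pow, ← map_zero (Ideal.Quotient.mk (nilCommIdeal k n r)).mapMatrix]
  refine map_mk_eq_map_mk fun x hx ↦ ?_
  rw [map_pow, map_eval_of_X, map_zero]
  simpa using Matrix.pow_card_eq_zero_of_isNilpotent (hx.1 i)

theorem eq_top_of_hasEntries_tautMatrix {T : Subalgebra k (MvPolynomial (Fin r × Fin n × Fin n) k ⧸
    nilCommIdeal k n r)} (h : ∀ i, T.HasEntries (tautMatrix k n r i)) : T = ⊤ := by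
  have hcomap : T.comap (Ideal.Quotient.mkₐ k (nilCommIdeal k n r)) = ⊤ := by
    rw [eq_top_iff, ← MvPolynomial.adjoin_range_X, Algebra.adjoin_le_iff]
    rintro _ ⟨⟨i, a, b⟩, rfl⟩
    exact h i a b
  refine eq_top_iff.2 fun y _ ↦ ?_
  obtain ⟨p, rfl⟩ := Ideal.Quotient.mk_surjective y
  have : p ∈ T.comap (Ideal.Quotient.mkₐ k (nilCommIdeal k n r)) := hcomap ▸ Algebra.mem_top
  exact this

/-- The nilpotent Jordan block. -/
def jordanShift (k : Type*) [Field k] (n : ℕ) : Matrix (Fin n) (Fin n) k :=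
  Matrix.of fun i j ↦ if (i : ℕ) = j + 1 then 1 else 0

theorem jordanShift_pow_apply (l : ℕ) (i j : Fin n) :
    (jordanShift k n ^ l) i j = if (i : ℕ) = j + l then 1 else 0 := by
  induction l generalizing i j with
  | zero => simp [Matrix.one_apply, Fin.ext_iff]
  | succ l ih =>
    rw [pow_succ, Matrix.mul_apply]
    simp_rw [ih, jordanShift, Matrix.of_apply]
    by_cases hj : (j : ℕ) + 1 < n
    · rw [Finset.sum_eq_single ⟨j + 1, hj⟩]
      · simp [add_assoc, add_comm 1 l]
      · intro b _ hb
        have : (b : ℕ) ≠ j + 1 := fun h ↦ hb (Fin.ext h)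
        simp [this]
      · simp
    · rw [if_neg (by omega)]
      exact Finset.sum_eq_zero fun b _ ↦ by
        rw [if_neg (c := (b : ℕ) = j + 1) (by omega), mul_zero]

theorem det_krylov_tautMatrix_ne_zero [NeZero n] (i : Fin r) :
    (krylov (tautMatrix k n r i)).det ≠ 0 := by
  have hV : krylov (tautMatrix k n r i) = (Ideal.Quotient.mk (nilCommIdeal k n r)).mapMatrix
      (krylov (Matrix.of fun a b ↦ X (i, a, b))) := by
    ext a b
    simp only [krylov, tautMatrix, Matrix.of_apply, ← map_pow]
    rfl
  rw [hV, ← RingHom.map_det, Ne, Ideal.Quotient.eq_zero_iff_mem, mem_nilCommIdeal]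
  intro h
  have hJ : (fun _ ↦ jordanShift k n) ∈ nilCommTuples k n r := by
    refine ⟨fun _ ↦ ⟨n, ?_⟩, fun _ _ ↦ rfl⟩
    ext a b
    rw [jordanShift_pow_apply, if_neg (by omega), Matrix.zero_apply]
  have h1 := h _ hJ
  have hK : (eval (tupleCoord fun _ : Fin r ↦ jordanShift k n)).mapMatrix
      (krylov (Matrix.of fun a b ↦ X (i, a, b))) = 1 := by
    ext a b
    have := congrFun (congrFun (map_eval_of_X (fun _ : Fin r ↦ jordanShift k n) i ▸
      (map_pow (eval (tupleCoord fun _ : Fin r ↦ jordanShift k n)).mapMatrix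
        (Matrix.of fun a b ↦ X (i, a, b)) (b : ℕ))) a) 0
    refine (this.trans (jordanShift_pow_apply _ _ _)).trans ?_
    simp [Matrix.one_apply, Fin.ext_iff]
  rw [RingHom.map_det, hK, Matrix.det_one] at h1
  exact one_ne_zero h1

open Cardinal in
theorem trdeg_nilCommTriples_le [NeZero n] (hp : (nilCommIdeal k n 3).IsPrime) :
    Algebra.trdeg k (MvPolynomial (Fin 3 × Fin n × Fin n) k ⧸ nilCommIdeal k n 3) ≤
      (n * (n - 1) + 2 * (n - 1) : ℕ) := by
  set S := MvPolynomial (Fin 3 × Fin n × Fin n) k ⧸ nilCommIdeal k n 3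
  have : IsDomain S := Ideal.Quotient.isDomain _
  let Y := tautMatrix k n 3
  let f : (Fin n × {j : Fin n // j ≠ 0}) ⊕ (Fin 2 × {j : Fin n // j ≠ 0}) → S :=
    Sum.elim (fun q ↦ krylov (Y 0) q.1 q.2) (fun q ↦ krylovCoord (Y 0) (Y q.1.succ) q.2)
  have halg : Algebra.IsAlgebraic (Algebra.adjoin k (Set.range f)) S := by
    refine isAlgebraic_of_forall_isDivClosed _ fun T hT hle ↦ eq_top_of_hasEntries_tautMatrix ?_
    have hf (q) : f q ∈ T := hle (Algebra.subset_adjoin ⟨q, rfl⟩)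
    have hV (i j) (hj : j ≠ 0) : krylov (Y 0) i j ∈ T := hf (.inl (i, ⟨j, hj⟩))
    have hd := det_krylov_tautMatrix_ne_zero (k := k) (n := n) (0 : Fin 3)
    intro i
    refine Fin.cases ?_ (fun i ↦ ?_) i
    · exact (hasEntries_of_krylov hT (tautMatrix_pow 0) hd hV).2
    · exact hasEntries_of_krylovCoord hT (tautMatrix_pow 0) (tautMatrix_pow _)
        (tautMatrix_commute _ _) hd hV fun j hj ↦ hf (.inr (i, ⟨j, hj⟩))
  refine (Algebra.IsAlgebraic.trdeg_le_cardinalMk k (Set.range f)).trans ?_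
  have h := mk_range_le_lift (f := f)
  rw [mk_fintype (_ ⊕ _)] at h
  simpa [Fintype.card_subtype_compl] using h

end VanishingIdeal

universe u in
theorem trdeg_le_of_isAlgebraic_range {k : Type*} {S A : Type u} [Field k] [CommRing S]
    [CommRing A] [IsDomain A] [Algebra k S] [Algebra k A] (f : S →ₐ[k] A)
    (h : Algebra.IsAlgebraic f.range A) : Algebra.trdeg k A ≤ Algebra.trdeg k S := by
  rw [← trdeg_add_eq k f.range (A := A), trdeg_eq_zero_iff.2 h, add_zero]
  exact trdeg_le_of_surjective f.rangeRestrict f.rangeRestrict_surjective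

theorem aeval_eq_zero_of_mem_nilCommIdeal {k σ : Type*} [Field k] [Infinite k] {n r : ℕ}
    {x : Fin r → Matrix (Fin n) (Fin n) (MvPolynomial σ k)} (hx : ∀ i, IsNilpotent (x i))
    (hc : ∀ i j, x i * x j = x j * x i) {p : MvPolynomial (Fin r × Fin n × Fin n) k}
    (hp : p ∈ nilCommIdeal k n r) : aeval (tupleCoord x) p = 0 := by
  refine MvPolynomial.funext fun v ↦ ?_
  have hv := mem_nilCommIdeal.1 hp (fun i ↦ (eval v).mapMatrix (x i))
    ⟨fun i ↦ (hx i).map _, fun i j ↦ by rw [← map_mul, hc, map_mul]⟩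
  rw [map_zero, ← hv, MvPolynomial.aeval_def, MvPolynomial.hom_eval₂]
  rw [MvPolynomial.eval, MvPolynomial.coe_eval₂Hom]
  congr 1
  ext a
  simp

/-- If `n = 4s` with `s ≥ 4` (i.e. `n ≥ 16` divisible by `4`), then `C₃(N_n)` is
reducible, i.e. not irreducible, in the Zariski topology. -/
theorem nilCommTriples_not_irreducible (k : Type*) [Field k] [IsAlgClosed k]
    (s : ℕ) (hs : 4 ≤ s) :
    letI := matTupleZariski k (4 * s) 3
    ¬ IsIrreducible (nilCommTuples k (4 * s) 3) := by
  intro hirr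
  have hp := nilCommIdeal_isPrime hirr
  have : NeZero (4 * s) := ⟨by omega⟩
  have : Infinite k := IsAlgClosed.instInfinite
  obtain ⟨x, hx, hc, hgen⟩ := exists_commuting_nilpotent_generating k s
  let f := Ideal.Quotient.liftₐ (nilCommIdeal k (4 * s) 3) (aeval (tupleCoord x))
    fun p hp ↦ aeval_eq_zero_of_mem_nilCommIdeal hx hc hp
  have hf : Algebra.IsAlgebraic f.range (MvPolynomial (Fin 17 × Fin s × Fin s) k) := by
    refine isAlgebraic_of_forall_isDivClosed _ fun T hT hle ↦ hgen T hT fun i a b ↦ hle ?_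
    exact ⟨Ideal.Quotient.mk _ (X (i, a, b)), aeval_X (tupleCoord x) (i, a, b)⟩
  have h := (trdeg_le_of_isAlgebraic_range f hf).trans (trdeg_nilCommTriples_le hp)
  rw [MvPolynomial.trdeg_of_isDomain, Cardinal.mk_fintype, Cardinal.lift_natCast, Nat.cast_le] at h
  obtain ⟨t, rfl⟩ := Nat.exists_eq_add_of_le hs
  simp only [Fintype.card_prod, Fintype.card_fin] at h
  rw [show 4 * (4 + t) - 1 = 15 + 4 * t by omega] at h
  nlinarith
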